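/- arXiv:2106.15521 — 3 statements merged into one kernel-verified Lean document; each statement's English description precedes it below -/
import Mathlib

section
/- Let n ≥ 1 be an integer and let α satisfy 0 < α < 1/2. Let u_0,…,u_n be the mid-p upper endpoints at level 1−α, and let v_0,…,v_n be any sequence with 0 ≤ v_0 ≤ v_1 ≤ ⋯ ≤ v_n = 1. Define the coverage C_w(p) of a nondecreasing endpoint sequence w with w_n = 1 by C_w(p) = Σ_{x=i}^n B(n,x,p) where i is the smallest index with p ≤ w_i (so C_w(p) = 1 when p ≤ w_0). Then for every p ∈ (0,1], |C_u(p) − (1−α)| ≤ |C_v(p) − (1−α)|; that is, among non-randomised upper-tail interval estimators, the mid-p method has coverage pointwise closest to the nominal level 1−α. -/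
open MeasureTheory

/-- The binomial probability mass function: `B n x p = C(n,x) p^x (1-p)^(n-x)`. -/
noncomputable def B (n x : ℕ) (p : ℝ) : ℝ :=
  (n.choose x : ℝ) * p ^ x * (1 - p) ^ (n - x)

/-- A sequence `0 < u 0 < u 1 < ⋯ < u n = 1` of OLC upper endpoints at level `1 - α`:
each inter-spike average coverage equals the nominal level. -/
def IsOLCUpper (n : ℕ) (α : ℝ) (u : ℕ → ℝ) : Prop :=
  0 < u 0 ∧ (∀ i, i < n → u i < u (i + 1)) ∧ u n = 1 ∧
    ∀ i, 1 ≤ i → i ≤ n →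
      (∫ p in (u (i - 1))..(u i), ∑ x ∈ Finset.Icc i n, B n x p)
        = (1 - α) * (u i - u (i - 1))

/-- A sequence `0 < v 0 < v 1 < ⋯ < v n = 1` giving upper-tail locally correct confidence
(LCC) intervals at level `1 - α`: each inter-spike average coverage is at least the
nominal level. -/
def IsLCCUpper (n : ℕ) (α : ℝ) (v : ℕ → ℝ) : Prop :=
  0 < v 0 ∧ (∀ i, i < n → v i < v (i + 1)) ∧ v n = 1 ∧
    ∀ i, 1 ≤ i → i ≤ n →
      (1 - α) * (v i - v (i - 1))
        ≤ ∫ p in (v (i - 1))..(v i), ∑ x ∈ Finset.Icc i n, B n x p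

/-- A sequence `0 = l 0 < l 1 < ⋯ < l n < 1` of OLC lower endpoints at level `1 - α`. -/
def IsOLCLower (n : ℕ) (α : ℝ) (l : ℕ → ℝ) : Prop :=
  l 0 = 0 ∧ (∀ i, i < n → l i < l (i + 1)) ∧ l n < 1 ∧
    ∀ i, i < n →
      (∫ p in (l i)..(l (i + 1)), ∑ x ∈ Finset.range (i + 1), B n x p)
        = (1 - α) * (l (i + 1) - l i)

/-- A sequence `0 = l 0 < l 1 < ⋯ < l n < 1` giving lower-tail LCC intervals at level
`1 - α`. -/
def IsLCCLower (n : ℕ) (α : ℝ) (l : ℕ → ℝ) : Prop :=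
  l 0 = 0 ∧ (∀ i, i < n → l i < l (i + 1)) ∧ l n < 1 ∧
    ∀ i, i < n →
      (1 - α) * (l (i + 1) - l i)
        ≤ ∫ p in (l i)..(l (i + 1)), ∑ x ∈ Finset.range (i + 1), B n x p

/-- Mid-p upper endpoints at level `1 - α`: `u n = 1` and, for `i < n`,
`u i ∈ (0,1)` solves `P(X < i) + (1/2) P(X = i) = α` at `p = u i`. -/
def IsMidPUpper (n : ℕ) (α : ℝ) (u : ℕ → ℝ) : Prop :=
  u n = 1 ∧ ∀ i, i < n → 0 < u i ∧ u i < 1 ∧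
    (∑ x ∈ Finset.range i, B n x (u i)) + (1 / 2) * B n i (u i) = α

/-- Mid-p lower endpoints at level `1 - α`: `l 0 = 0` and, for `1 ≤ i ≤ n`,
`l i ∈ (0,1)` solves `P(X > i) + (1/2) P(X = i) = α` at `p = l i`. -/
def IsMidPLower (n : ℕ) (α : ℝ) (l : ℕ → ℝ) : Prop :=
  l 0 = 0 ∧ ∀ i, 1 ≤ i → i ≤ n → 0 < l i ∧ l i < 1 ∧
    (∑ x ∈ Finset.Icc (i + 1) n, B n x (l i)) + (1 / 2) * B n i (l i) = α

/-- The coverage of an upper-tail endpoint sequence `w` at `p`: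
`∑_{x=i}^n B(n,x,p)` where `i` is the smallest index with `p ≤ w i`. -/
noncomputable def cov (n : ℕ) (w : ℕ → ℝ) (p : ℝ) : ℝ :=
  ∑ x ∈ Finset.Icc (sInf {i : ℕ | p ≤ w i}) n, B n x p

theorem hasDerivAt_sum_range_B (n k : ℕ) (p : ℝ) :
    HasDerivAt (fun q => ∑ x ∈ Finset.range k, B n x q)
      (-((n.choose k * k : ℕ) : ℝ) * p ^ (k - 1) * (1 - p) ^ (n - k)) p := by
  induction k with
  | zero => simpa using hasDerivAt_const p (0 : ℝ)
  | succ k ih =>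
    have hB : HasDerivAt (fun q => B n k q)
        ((n.choose k : ℝ) * (k * p ^ (k - 1)) * (1 - p) ^ (n - k)
          + (n.choose k : ℝ) * p ^ k * (((n - k : ℕ) : ℝ) * (1 - p) ^ (n - k - 1) * (-1))) p :=
      ((hasDerivAt_pow k p).const_mul (n.choose k : ℝ)).mul
        (((hasDerivAt_id p).const_sub 1).pow (n - k))
    simp only [Finset.sum_range_succ]
    refine (ih.add hB).congr_deriv ?_
    rw [Nat.choose_succ_right_eq, Nat.add_sub_cancel, ← Nat.sub_sub]
    push_cast
    ring

theorem antitoneOn_sum_range_B (n k : ℕ) :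
    AntitoneOn (fun q => ∑ x ∈ Finset.range k, B n x q) (Set.Icc 0 1) := by
  refine antitoneOn_of_deriv_nonpos (convex_Icc 0 1)
    (fun p _ => (hasDerivAt_sum_range_B n k p).continuousAt.continuousWithinAt)
    (fun p _ => (hasDerivAt_sum_range_B n k p).differentiableAt.differentiableWithinAt)
    (fun p hp => ?_)
  rw [interior_Icc] at hp
  have hp1 : 0 ≤ 1 - p := sub_nonneg.2 hp.2.le
  have hp0 : 0 ≤ p := hp.1.le
  rw [(hasDerivAt_sum_range_B n k p).deriv, neg_mul, neg_mul, neg_nonpos]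
  positivity

theorem sum_range_succ_B (n : ℕ) (p : ℝ) : ∑ x ∈ Finset.range (n + 1), B n x p = 1 := by
  have h := add_pow p (1 - p) n
  rw [add_sub_cancel, one_pow] at h
  rw [h]
  exact Finset.sum_congr rfl fun x _ => by rw [B]; ring

theorem sum_Icc_B (n i : ℕ) (hi : i ≤ n) (p : ℝ) :
    ∑ x ∈ Finset.Icc i n, B n x p = 1 - ∑ x ∈ Finset.range i, B n x p := by
  rw [← sum_range_succ_B n p, ← Finset.sum_range_add_sum_Ico _ (Nat.le_succ_of_le hi),
    add_sub_cancel_left]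
  rfl

theorem monotone_sum_range_B (n : ℕ) {p : ℝ} (hp0 : 0 ≤ p) (hp1 : p ≤ 1) :
    Monotone fun k => ∑ x ∈ Finset.range k, B n x p := by
  have hq : 0 ≤ 1 - p := sub_nonneg.2 hp1
  refine monotone_nat_of_le_succ fun k => ?_
  rw [Finset.sum_range_succ, le_add_iff_nonneg_right, B]
  positivity

theorem stmt_7 (n : ℕ) (hn : 1 ≤ n)
    (α : ℝ) (hα1 : 0 < α) (hα2 : α < 1 / 2)
    (u : ℕ → ℝ) (hu : IsMidPUpper n α u)
    (v : ℕ → ℝ) (hv0 : 0 ≤ v 0) (hvmono : ∀ i, i < n → v i ≤ v (i + 1))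
    (hvn : v n = 1) :
    ∀ p : ℝ, 0 < p → p ≤ 1 →
      |cov n u p - (1 - α)| ≤ |cov n v p - (1 - α)| := by
  intro p hp0 hp1
  obtain ⟨hun, hu⟩ := hu
  have hunp : n ∈ {i : ℕ | p ≤ u i} := hp1.trans_eq hun.symm
  have hi : sInf {i : ℕ | p ≤ u i} ≤ n := Nat.sInf_le hunp
  have hiu : p ≤ u (sInf {i : ℕ | p ≤ u i}) := Nat.sInf_mem ⟨n, hunp⟩
  have hlt : ∀ k < sInf {i : ℕ | p ≤ u i}, u k < p := fun k hk =>
    not_le.1 (Nat.notMem_of_lt_sInf hk)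
  have hj : sInf {i : ℕ | p ≤ v i} ≤ n := Nat.sInf_le (hp1.trans_eq hvn.symm)
  rw [cov, cov, sum_Icc_B n _ hi, sum_Icc_B n _ hj]
  generalize sInf {i : ℕ | p ≤ u i} = i at hi hiu hlt ⊢
  generalize sInf {i : ℕ | p ≤ v i} = j at hj ⊢
  have hp : p ∈ Set.Icc (0 : ℝ) 1 := ⟨hp0.le, hp1⟩
  have hmono := monotone_sum_range_B n hp0.le hp1
  have hmid : ∀ k < n, u k ∈ Set.Icc (0 : ℝ) 1 ∧
      (∑ x ∈ Finset.range k, B n x (u k)) + ∑ x ∈ Finset.range (k + 1), B n x (u k)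
        = 2 * α := by
    intro k hk
    obtain ⟨h0, h1, h⟩ := hu k hk
    refine ⟨⟨h0.le, h1.le⟩, ?_⟩
    rw [Finset.sum_range_succ]
    linarith
  rcases lt_trichotomy j i with hji | rfl | hij
  · obtain ⟨k, rfl⟩ : ∃ k, i = k + 1 := ⟨i - 1, by omega⟩
    obtain ⟨hk, hs⟩ := hmid k (by omega)
    have huk := (hlt k (by omega)).le
    have h1 := antitoneOn_sum_range_B n k hk hp huk
    have h2 := antitoneOn_sum_range_B n (k + 1) hk hp huk
    have h3 := hmono (Nat.le_of_lt_succ hji)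
    have h4 := hmono (Nat.le_succ k)
    simp only [Nat.succ_eq_add_one] at h1 h2 h3 h4
    exact (abs_le.2 ⟨by linarith, by linarith⟩).trans (le_abs_self _)
  · exact le_rfl
  · obtain ⟨hk, hs⟩ := hmid i (by omega)
    have h1 := antitoneOn_sum_range_B n i hp hk hiu
    have h2 := antitoneOn_sum_range_B n (i + 1) hp hk hiu
    have h3 := hmono (Nat.succ_le_of_lt hij)
    have h4 := hmono (Nat.le_succ i)
    simp only [Nat.succ_eq_add_one] at h1 h2 h3 h4
    exact (abs_le.2 ⟨by linarith, by linarith⟩).trans (neg_le_abs _)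
end

section
/- Let n ≥ 1 be an integer and let i be an integer with 0 ≤ i ≤ n−1. Then the function h(p) = Σ_{x=0}^{i−1} B(n,x,p) + (1/2)·B(n,i,p) is strictly decreasing on [0,1], with h(1) = 0 and h(0) = 1 if i ≥ 1 and h(0) = 1/2 if i = 0. Consequently, for every α with 0 < α < 1/2 there exists a unique u_i ∈ (0,1) satisfying the mid-p equation Σ_{x=0}^{i−1} B(n,x,u_i) + (1/2)·B(n,i,u_i) = α. -/
open MeasureTheory

lemma B_eq_eval_bernsteinPolynomial (n x : ℕ) (p : ℝ) :
    B n x p = (bernsteinPolynomial ℝ n x).eval p := by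
  simp [B, bernsteinPolynomial]

lemma B_nonneg (n x : ℕ) {p : ℝ} (h₀ : 0 ≤ p) (h₁ : p ≤ 1) : 0 ≤ B n x p := by
  have : 0 ≤ 1 - p := sub_nonneg.2 h₁
  unfold B
  positivity

lemma B_pos {n x : ℕ} (hx : x ≤ n) {p : ℝ} (h₀ : 0 < p) (h₁ : p < 1) : 0 < B n x p := by
  have : 0 < 1 - p := sub_pos.2 h₁
  have : 0 < n.choose x := Nat.choose_pos hx
  unfold B
  positivity

lemma B_one_of_lt {n x : ℕ} (hx : x < n) : B n x 1 = 0 := by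
  simp [B, Nat.sub_ne_zero_of_lt hx]

lemma B_zero_right (n x : ℕ) : B n x 0 = if x = 0 then 1 else 0 := by
  split_ifs with h <;> simp [B, h]

lemma derivative_sum_bernsteinPolynomial (n k : ℕ) :
    Polynomial.derivative (∑ x ∈ Finset.range (k + 1), bernsteinPolynomial ℝ n x) =
      -n * bernsteinPolynomial ℝ (n - 1) k := by
  induction k with
  | zero => simp [bernsteinPolynomial.derivative_zero]
  | succ k ih =>
    rw [Finset.sum_range_succ, Polynomial.derivative_add, ih, bernsteinPolynomial.derivative_succ]
    ring

/-- The derivative of a binomial distribution function with respect to the success probability. -/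
lemma hasDerivAt_sum_B (n k : ℕ) (p : ℝ) :
    HasDerivAt (fun p => ∑ x ∈ Finset.range (k + 1), B n x p) (-n * B (n - 1) k p) p := by
  have h := (∑ x ∈ Finset.range (k + 1), bernsteinPolynomial ℝ n x).hasDerivAt p
  rw [derivative_sum_bernsteinPolynomial] at h
  simpa [Polynomial.eval_finsetSum, B_eq_eval_bernsteinPolynomial] using h

lemma continuous_sum_B (n k : ℕ) : Continuous (fun p => ∑ x ∈ Finset.range k, B n x p) := by
  unfold B
  fun_prop

lemma antitoneOn_sum_B (n k : ℕ) :
    AntitoneOn (fun p => ∑ x ∈ Finset.range k, B n x p) (Set.Icc 0 1) := by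
  cases k with
  | zero => simp [AntitoneOn]
  | succ k =>
    refine antitoneOn_of_deriv_nonpos (convex_Icc 0 1) (continuous_sum_B n _).continuousOn
      (fun p _ => (hasDerivAt_sum_B n k p).differentiableAt.differentiableWithinAt) fun p hp => ?_
    rw [interior_Icc] at hp
    rw [(hasDerivAt_sum_B n k p).deriv, neg_mul, neg_nonpos]
    exact mul_nonneg n.cast_nonneg (B_nonneg _ _ hp.1.le hp.2.le)

lemma strictAntiOn_sum_B {n k : ℕ} (hk : k < n) :
    StrictAntiOn (fun p => ∑ x ∈ Finset.range (k + 1), B n x p) (Set.Icc 0 1) := by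
  refine strictAntiOn_of_deriv_neg (convex_Icc 0 1) (continuous_sum_B n _).continuousOn
    fun p hp => ?_
  rw [interior_Icc] at hp
  rw [(hasDerivAt_sum_B n k p).deriv, neg_mul, neg_lt_zero]
  exact mul_pos (Nat.cast_pos.2 (by omega)) (B_pos (by omega) hp.1 hp.2)

theorem stmt_10 (n i : ℕ) (hn : 1 ≤ n) (hi : i ≤ n - 1) :
    StrictAntiOn
        (fun p : ℝ => (∑ x ∈ Finset.range i, B n x p) + (1 / 2) * B n i p)
        (Set.Icc 0 1) ∧
      (∑ x ∈ Finset.range i, B n x (1 : ℝ)) + (1 / 2) * B n i 1 = 0 ∧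
      (1 ≤ i → (∑ x ∈ Finset.range i, B n x (0 : ℝ)) + (1 / 2) * B n i 0 = 1) ∧
      (i = 0 → (∑ x ∈ Finset.range i, B n x (0 : ℝ)) + (1 / 2) * B n i 0 = 1 / 2) ∧
      ∀ α : ℝ, 0 < α → α < 1 / 2 →
        ∃! uᵢ : ℝ, 0 < uᵢ ∧ uᵢ < 1 ∧
          (∑ x ∈ Finset.range i, B n x uᵢ) + (1 / 2) * B n i uᵢ = α := by
  have hin : i < n := by omega
  have hanti : StrictAntiOn
      (fun p : ℝ => (∑ x ∈ Finset.range i, B n x p) + (1 / 2) * B n i p) (Set.Icc 0 1) := by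
    intro p hp q hq hpq
    have h₁ := antitoneOn_sum_B n i hp hq hpq.le
    have h₂ := strictAntiOn_sum_B hin hp hq hpq
    simp only [Finset.sum_range_succ] at h₁ h₂ ⊢
    linarith
  have hone : (∑ x ∈ Finset.range i, B n x (1 : ℝ)) + (1 / 2) * B n i 1 = 0 := by
    rw [B_one_of_lt hin, Finset.sum_eq_zero fun x hx =>
      B_one_of_lt ((Finset.mem_range.1 hx).trans hin)]
    simp
  have hzero_of_pos : 1 ≤ i →
      (∑ x ∈ Finset.range i, B n x (0 : ℝ)) + (1 / 2) * B n i 0 = 1 := by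
    intro h
    have hi₀ : i ≠ 0 := by omega
    simp [B_zero_right, hi₀, Nat.pos_iff_ne_zero]
  have hzero_of_eq : i = 0 →
      (∑ x ∈ Finset.range i, B n x (0 : ℝ)) + (1 / 2) * B n i 0 = 1 / 2 := by
    rintro rfl
    simp [B_zero_right]
  refine ⟨hanti, hone, hzero_of_pos, hzero_of_eq, fun α hα₀ hα₁ => ?_⟩
  have hcont : Continuous
      (fun p : ℝ => (∑ x ∈ Finset.range i, B n x p) + (1 / 2) * B n i p) := by
    unfold B
    fun_prop
  have hzero : α < (∑ x ∈ Finset.range i, B n x (0 : ℝ)) + (1 / 2) * B n i 0 := by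
    rcases Nat.eq_zero_or_pos i with h | h
    · rwa [hzero_of_eq h]
    · rw [hzero_of_pos h]
      linarith
  obtain ⟨u, hu, hu_eq⟩ := intermediate_value_Ioo' zero_le_one hcont.continuousOn
    ⟨hone.trans_lt hα₀, hzero⟩
  refine ⟨u, ⟨hu.1, hu.2, hu_eq⟩, fun v hv => ?_⟩
  exact hanti.injOn ⟨hv.1.le, hv.2.1.le⟩ ⟨hu.1.le, hu.2.le⟩ (hv.2.2.trans hu_eq.symm)
end

section
/- Let n ≥ 1 be an integer, let 0 < α < 1, and suppose 0 < u_0 < u_1 < ⋯ < u_n = 1 are OLC upper endpoints at level 1−α, i.e. ∫_{u_{i−1}}^{u_i} Σ_{x=i}^n B(n,x,p) dp = (1−α)(u_i − u_{i−1}) for every i = 1,…,n. Define l_x = 1 − u_{n−x} for x = 0,…,n. Then 0 = l_0 < l_1 < ⋯ < l_n < 1 and ∫_{l_i}^{l_{i+1}} Σ_{x=0}^{i} B(n,x,p) dp = (1−α)(l_{i+1} − l_i) for every i = 0,…,n−1; that is, the OLC method is equivariant under the transformation x ↦ n−x, p ↦ 1−p, its lower endpoints being the reflections of its upper endpoints.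 -/
open MeasureTheory

theorem B_one_sub {n x : ℕ} (hx : x ≤ n) (p : ℝ) : B n x (1 - p) = B n (n - x) p := by
  simp only [B, Nat.choose_symm hx, Nat.sub_sub_self hx, sub_sub_cancel]
  ring

theorem sum_range_B_one_sub {n i : ℕ} (hi : i < n) (p : ℝ) :
    ∑ x ∈ Finset.range (i + 1), B n x (1 - p) = ∑ x ∈ Finset.Icc (n - i) n, B n x p := by
  refine Finset.sum_bij' (fun x _ => n - x) (fun x _ => n - x) ?_ ?_ ?_ ?_ ?_
  · intro x hx
    simp only [Finset.mem_range, Finset.mem_Icc] at hx ⊢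
    omega
  · intro x hx
    simp only [Finset.mem_range, Finset.mem_Icc] at hx ⊢
    omega
  · intro x hx
    simp only [Finset.mem_range] at hx
    omega
  · intro x hx
    simp only [Finset.mem_Icc] at hx
    omega
  · intro x hx
    simp only [Finset.mem_range] at hx
    exact B_one_sub (by omega) p

theorem integral_sum_range_B {n i : ℕ} (hi : i < n) (a b : ℝ) :
    (∫ p in (1 - b)..(1 - a), ∑ x ∈ Finset.range (i + 1), B n x p)
      = ∫ p in a..b, ∑ x ∈ Finset.Icc (n - i) n, B n x p := by
  rw [← intervalIntegral.integral_comp_sub_left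
    (fun p => ∑ x ∈ Finset.range (i + 1), B n x p) 1]
  simp only [sum_range_B_one_sub hi]

theorem stmt_14 (n : ℕ) (hn : 1 ≤ n)
    (α : ℝ) (hα1 : 0 < α) (hα2 : α < 1)
    (u : ℕ → ℝ) (hu : IsOLCUpper n α u)
    (l : ℕ → ℝ) (hl : ∀ x, x ≤ n → l x = 1 - u (n - x)) :
    l 0 = 0 ∧ (∀ i, i < n → l i < l (i + 1)) ∧ l n < 1 ∧
      ∀ i, i < n →
        (∫ p in (l i)..(l (i + 1)), ∑ x ∈ Finset.range (i + 1), B n x p)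
          = (1 - α) * (l (i + 1) - l i) := by
  obtain ⟨h0, hmono, hone, hint⟩ := hu
  refine ⟨by simp [hl 0 (Nat.zero_le n), hone], fun i hi => ?_, ?_, fun i hi => ?_⟩
  · have h := hmono (n - (i + 1)) (by omega)
    rw [show n - (i + 1) + 1 = n - i by omega] at h
    rw [hl i hi.le, hl (i + 1) hi]
    linarith
  · rw [hl n le_rfl, Nat.sub_self]
    linarith
  · have h := hint (n - i) (by omega) (by omega)
    rw [hl i hi.le, hl (i + 1) hi, integral_sum_range_B hi, ← Nat.sub_sub, h]
    ring
end
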